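/- Let N ≥ 1 and let φ : Λ_N → ℤ≥0. For A ⊆ φ^{−1}(0), define U_A φ : Λ_N → ℤ≥0 by (U_A φ)(x) = φ(x) + 1 if x ∉ A and (U_A φ)(x) = 0 if x ∈ A. Then H_N(U_A φ) ≤ H_N(φ) + 4|A| + 4N. -/

import Mathlib

open Real Finset
open scoped Classical

noncomputable section

/-- The box `Λ_N = {1,…,N}²` in `ℤ²`. -/
def Lam (N : ℕ) : Finset (ℤ × ℤ) := Finset.Icc (1:ℤ) (N:ℤ) ×ˢ Finset.Icc (1:ℤ) (N:ℤ)

/-- The four nearest neighbors of a site of `ℤ²`. -/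
def nbrs (x : ℤ × ℤ) : Finset (ℤ × ℤ) :=
  {(x.1 + 1, x.2), (x.1 - 1, x.2), (x.1, x.2 + 1), (x.1, x.2 - 1)}

/-- An enlarged box containing all edges touching `Λ_N`. -/
def Box (N : ℕ) : Finset (ℤ × ℤ) := Finset.Icc (0:ℤ) ((N:ℤ)+1) ×ˢ Finset.Icc (0:ℤ) ((N:ℤ)+1)

/-- The SOS Hamiltonian with zero boundary conditions, for fields vanishing outside `Λ_N`:
each edge `{x,y}` with `x ~ y` touching `Λ_N` is counted twice in the double sum (once from
each endpoint, both endpoints lying in `Box N`), whence the factor `1/2`.  Since the field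
vanishes outside `Λ_N`, this equals
`Σ_{{x,y}⊂Λ_N, x~y} |φ(x)−φ(y)| + Σ_{x∈Λ_N, y∉Λ_N, x~y} |φ(x)|`. -/
def Ham (N : ℕ) (φ : ℤ × ℤ → ℤ) : ℝ :=
  (1/2) * ∑ x ∈ Box N, ∑ y ∈ nbrs x, |(φ x : ℝ) - (φ y : ℝ)|

/-- The level set `φ⁻¹(k)` inside `Λ_N`. -/
def levelSet (N : ℕ) (φ : ℤ × ℤ → ℤ) (k : ℤ) : Finset (ℤ × ℤ) :=
  (Lam N).filter fun x => φ x = k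

/-- The configuration space `Ω_N`: nonnegative integer fields vanishing outside `Λ_N`. -/
def Conf (N : ℕ) : Type :=
  {φ : ℤ × ℤ → ℤ // (∀ x, 0 ≤ φ x) ∧ ∀ x ∉ Lam N, φ x = 0}

/-- The Boltzmann weight `exp(−β H_N(φ) + h |φ⁻¹(0)|)`. -/
def weight (N : ℕ) (β h : ℝ) (φ : ℤ × ℤ → ℤ) : ℝ :=
  Real.exp (-β * Ham N φ + h * ((levelSet N φ 0).card : ℝ))

/-- The partition function `Z_N^{β,h}`. -/
def Z (N : ℕ) (β h : ℝ) : ℝ := ∑' φ : Conf N, weight N β h φ.val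

/-- The probability of an event `E ⊆ Ω_N` under `P_N^{β,h}`. -/
def prob (N : ℕ) (β h : ℝ) (E : Set (Conf N)) : ℝ :=
  (∑' φ : Conf N, if φ ∈ E then weight N β h φ.val else 0) / Z N β h

/-- The critical pinning value `h_w(β) = log(e^{4β}/(e^{4β}−1))`. -/
def hw (β : ℝ) : ℝ := Real.log (Real.exp (4*β) / (Real.exp (4*β) - 1))

/-- The lifting map `U_A`: raise the surface by one everywhere on `Λ_N` except on `A`,
which is kept at height `0` (and extend by `0` outside `Λ_N`). -/
def UA (N : ℕ) (A : Finset (ℤ × ℤ)) (φ : ℤ × ℤ → ℤ) : ℤ × ℤ → ℤ :=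
  fun x => if x ∈ Lam N then (if x ∈ A then 0 else φ x + 1) else 0

theorem sum_nbrs (x : ℤ × ℤ) (f : ℤ × ℤ → ℝ) :
    ∑ y ∈ nbrs x, f y =
      f (x.1 + 1, x.2) + f (x.1 - 1, x.2) + f (x.1, x.2 + 1) + f (x.1, x.2 - 1) := by
  unfold nbrs
  rw [sum_insert, sum_insert, sum_insert, sum_singleton]
  · ring
  all_goals
    simp only [mem_insert, mem_singleton, Prod.mk.injEq]
    omega

theorem card_pair_product_Icc_le (N : ℕ) (a b : ℤ) :
    (({a, b} : Finset ℤ) ×ˢ Icc (1 : ℤ) N).card ≤ 2 * N := by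
  rw [card_product, Int.card_Icc]
  have : ((N : ℤ) + 1 - 1).toNat = N := by omega
  rw [this]
  exact Nat.mul_le_mul_right N card_le_two

theorem sum_indicator_comp_le_card {α : Type*} [DecidableEq α] (s T : Finset α) {g : α → α}
    (hg : Function.Injective g) :
    ∑ x ∈ s, (if g x ∈ T then (1 : ℝ) else 0) ≤ T.card := by
  rw [sum_boole]
  exact_mod_cast card_le_card_of_injOn g (fun x hx => (mem_filter.1 hx).2) hg.injOn

theorem abs_UA_sub_le {N : ℕ} (φ : Conf N) {A : Finset (ℤ × ℤ)}
    (hA : A ⊆ levelSet N φ.val 0) (x y : ℤ × ℤ) :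
    |UA N A φ.val x - UA N A φ.val y| ≤ |φ.val x - φ.val y| +
      (if x ∈ A then 1 else 0) + (if y ∈ A then 1 else 0) +
      (if x ∈ Lam N ↔ y ∈ Lam N then 0 else 1) := by
  have zero_of_mem (z) (hz : z ∈ A) : φ.val z = 0 := (mem_filter.1 (hA hz)).2
  have hx := zero_of_mem x
  have hy := zero_of_mem y
  have hx' := φ.2.2 x
  have hy' := φ.2.2 y
  simp only [UA, abs_eq_max_neg]
  by_cases h1 : x ∈ Lam N <;> by_cases h2 : y ∈ Lam N <;> by_cases h3 : x ∈ A <;>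
    by_cases h4 : y ∈ A <;> simp only [h1, h2, h3, h4, not_true, not_false_eq_true,
      forall_const, if_true, if_false, iff_self, iff_true, iff_false] at * <;> omega

/-- Energy estimate along a single direction `x ↦ g x`: the edges outside `T` do not cross the
boundary of `Λ_N`. -/
theorem sum_abs_UA_sub_le {N : ℕ} (φ : Conf N) (A : Finset (ℤ × ℤ))
    (hA : A ⊆ levelSet N φ.val 0) (g : ℤ × ℤ → ℤ × ℤ) (hg : Function.Injective g)
    (T : Finset (ℤ × ℤ)) (hT : T.card ≤ 2 * N)
    (h : ∀ x ∉ T, (x ∈ Lam N ↔ g x ∈ Lam N)) :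
    ∑ x ∈ Box N, |(UA N A φ.val x : ℝ) - (UA N A φ.val (g x) : ℝ)| ≤
      ∑ x ∈ Box N, |(φ.val x : ℝ) - (φ.val (g x) : ℝ)| + 2 * (A.card : ℝ) + 2 * (N : ℝ) := by
  have pointwise : ∀ x ∈ Box N, |(UA N A φ.val x : ℝ) - (UA N A φ.val (g x) : ℝ)| ≤
      |(φ.val x : ℝ) - (φ.val (g x) : ℝ)| + (if x ∈ A then (1 : ℝ) else 0) +
        (if g x ∈ A then (1 : ℝ) else 0) + (if x ∈ T then (1 : ℝ) else 0) := by
    intro x _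
    have edge := abs_UA_sub_le φ hA x (g x)
    have crossing : (if x ∈ Lam N ↔ g x ∈ Lam N then (0 : ℤ) else 1) ≤
        if x ∈ T then 1 else 0 := by
      by_cases hx : x ∈ T
      · rw [if_pos hx]; split_ifs <;> norm_num
      · rw [if_neg hx, if_pos (h x hx)]
    exact_mod_cast edge.trans (add_le_add_right crossing _)
  have total := sum_le_sum pointwise
  simp only [sum_add_distrib] at total
  have source := sum_indicator_comp_le_card (Box N) A Function.injective_id
  have target := sum_indicator_comp_le_card (Box N) A hg
  have boundary := sum_indicator_comp_le_card (Box N) T Function.injective_id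
  simp only [id] at source boundary
  have hT' : (T.card : ℝ) ≤ 2 * N := by exact_mod_cast hT
  linarith

/-- Energy estimate for the lifting map: `H_N(U_A φ) ≤ H_N(φ) + 4|A| + 4N`. -/
theorem Ham_UA_le (N : ℕ) (hN : 1 ≤ N) (φ : Conf N) (A : Finset (ℤ × ℤ))
    (hA : A ⊆ levelSet N φ.val 0) :
    Ham N (UA N A φ.val) ≤ Ham N φ.val + 4 * (A.card : ℝ) + 4 * (N:ℝ) := by
  have right := sum_abs_UA_sub_le φ A hA (fun x => (x.1 + 1, x.2))
    (fun x y h => by simp only [Prod.mk.injEq] at h; ext <;> omega)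
    (({0, (N : ℤ)} : Finset ℤ) ×ˢ Icc (1 : ℤ) N)
    (by have := card_pair_product_Icc_le N 0 N; omega)
    (fun x hx => by simp only [Lam, mem_product, mem_Icc, mem_insert, mem_singleton] at *; omega)
  have left := sum_abs_UA_sub_le φ A hA (fun x => (x.1 - 1, x.2))
    (fun x y h => by simp only [Prod.mk.injEq] at h; ext <;> omega)
    (({1, (N : ℤ) + 1} : Finset ℤ) ×ˢ Icc (1 : ℤ) N)
    (by have := card_pair_product_Icc_le N 1 (N + 1); omega)
    (fun x hx => by simp only [Lam, mem_product, mem_Icc, mem_insert, mem_singleton] at *; omega)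
  have up := sum_abs_UA_sub_le φ A hA (fun x => (x.1, x.2 + 1))
    (fun x y h => by simp only [Prod.mk.injEq] at h; ext <;> omega)
    (Icc (1 : ℤ) N ×ˢ ({0, (N : ℤ)} : Finset ℤ))
    (by have := card_pair_product_Icc_le N 0 N; rw [card_product] at *; lia)
    (fun x hx => by simp only [Lam, mem_product, mem_Icc, mem_insert, mem_singleton] at *; omega)
  have down := sum_abs_UA_sub_le φ A hA (fun x => (x.1, x.2 - 1))
    (fun x y h => by simp only [Prod.mk.injEq] at h; ext <;> omega)
    (Icc (1 : ℤ) N ×ˢ ({1, (N : ℤ) + 1} : Finset ℤ))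
    (by have := card_pair_product_Icc_le N 1 (N + 1); rw [card_product] at *; lia)
    (fun x hx => by simp only [Lam, mem_product, mem_Icc, mem_insert, mem_singleton] at *; omega)
  simp only [Ham, sum_nbrs, sum_add_distrib]
  linarith
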